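/- arXiv:1109.5635 — 5 statements merged into one kernel-verified Lean document; each statement's English description precedes it below -/
import Mathlib

section
/- There is an absolute constant C > 0 such that the following holds (Bourgain's embedding). For every finite metric space (X, ρ) with |X| = n ≥ 2, there exist a natural number t ≤ C·(log₂ n)² and a map f : X → ℝ^t such that for all u, v ∈ X: ρ(u,v) ≤ ‖f(u) − f(v)‖₁ ≤ C·(log₂ n)·ρ(u,v). -/
open Finset in
/-- Derandomized sampling: if each event `P i` has probability at least `p` under the uniform
measure on `Ω`, some sequence of `m` samples keeps the exponential potential
`∑ i, 2 ^ (-#{k | P i (w k)})` below its expectation. -/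
lemma exists_samples_potential_le {Ω ι : Type*} [Fintype Ω] [Nonempty Ω] [Fintype ι]
    (P : ι → Ω → Prop) [∀ i ω, Decidable (P i ω)] (p : ℝ)
    (h : ∀ i, p * Fintype.card Ω ≤ #{ω | P i ω}) (m : ℕ) :
    ∃ w : Fin m → Ω, ∑ i, ∏ k, (if P i (w k) then (1 / 2 : ℝ) else 1) ≤
      Fintype.card ι * (1 - p / 2) ^ m := by
  rcases isEmpty_or_nonempty ι with hι | ⟨⟨i₀⟩⟩
  · exact ⟨fun _ ↦ Classical.arbitrary Ω, by simp⟩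
  have hΩ : (0 : ℝ) < Fintype.card Ω := by exact_mod_cast Fintype.card_pos
  have hp : p ≤ 1 := by
    have h₁ : (#{ω | P i₀ ω} : ℝ) ≤ Fintype.card Ω := by exact_mod_cast card_le_univ _
    have := (h i₀).trans h₁
    by_contra! hlt
    nlinarith
  induction m with
  | zero => exact ⟨Fin.elim0, by simp⟩
  | succ m ih =>
    obtain ⟨w, hw⟩ := ih
    set a : ι → ℝ := fun i ↦ ∏ k, (if P i (w k) then (1 / 2 : ℝ) else 1)
    have ha0 : ∀ i, 0 ≤ a i := fun i ↦ prod_nonneg fun k _ ↦ by split_ifs <;> norm_num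
    have hone : ∀ i, ∑ ω, (if P i ω then (1 / 2 : ℝ) else 1) ≤
        (1 - p / 2) * Fintype.card Ω := by
      intro i
      have hrw : ∀ ω, (if P i ω then (1 / 2 : ℝ) else 1) = 1 - 1 / 2 * (if P i ω then 1 else 0) := by
        intro ω
        split_ifs <;> norm_num
      have hi := h i
      simp only [hrw, sum_sub_distrib, ← mul_sum, sum_boole, sum_const, card_univ, nsmul_eq_mul,
        mul_one]
      linarith
    have havg : ∑ ω, ∑ i, (if P i ω then (1 / 2 : ℝ) else 1) * a i ≤
        ∑ _ω : Ω, (1 - p / 2) * ∑ i, a i := by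
      rw [sum_comm]
      simp only [← sum_mul, sum_const, card_univ, nsmul_eq_mul]
      calc ∑ i, (∑ ω, (if P i ω then (1 / 2 : ℝ) else 1)) * a i
          ≤ ∑ i, ((1 - p / 2) * Fintype.card Ω) * a i :=
            sum_le_sum fun i _ ↦ mul_le_mul_of_nonneg_right (hone i) (ha0 i)
        _ = _ := by rw [← mul_sum]; ring
    obtain ⟨ω, -, hω⟩ := exists_le_of_sum_le univ_nonempty havg
    refine ⟨Fin.cons ω w, ?_⟩
    simp only [Fin.prod_univ_succ, Fin.cons_zero, Fin.cons_succ]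
    calc _ ≤ (1 - p / 2) * ∑ i, a i := hω
      _ ≤ (1 - p / 2) * (Fintype.card ι * (1 - p / 2) ^ m) :=
        mul_le_mul_of_nonneg_left hw (by linarith)
      _ = _ := by ring

open Finset in
/-- With `51 * L` samples and at most `2 ^ (2 * L)` events of probability at least `1 / 12`, every
event can be made to occur at least `L` times. -/
lemma exists_samples_card_ge {Ω ι : Type*} [Fintype Ω] [Nonempty Ω] [Fintype ι]
    (P : ι → Ω → Prop) [∀ i ω, Decidable (P i ω)]
    (h : ∀ i, (1 / 12 : ℝ) * Fintype.card Ω ≤ #{ω | P i ω}) (L : ℕ)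
    (hL : Fintype.card ι ≤ 2 ^ (2 * L)) :
    ∃ w : Fin (51 * L) → Ω, ∀ i, L ≤ #{k | P i (w k)} := by
  obtain ⟨w, hw⟩ := exists_samples_potential_le P (1 / 12) h (51 * L)
  refine ⟨w, fun i ↦ ?_⟩
  have hi : ∏ k, (if P i (w k) then (1 / 2 : ℝ) else 1) ≤
      Fintype.card ι * (1 - 1 / 12 / 2) ^ (51 * L) :=
    (single_le_sum (f := fun i ↦ ∏ k, (if P i (w k) then (1 / 2 : ℝ) else 1))
      (fun i _ ↦ prod_nonneg fun k _ ↦ by split_ifs <;> norm_num) (mem_univ i)).trans hw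
  rw [prod_ite, prod_const, prod_const_one, mul_one] at hi
  have hbound : (Fintype.card ι : ℝ) * (1 - 1 / 12 / 2) ^ (51 * L) ≤ (1 / 2) ^ L := by
    calc (Fintype.card ι : ℝ) * (1 - 1 / 12 / 2) ^ (51 * L)
        ≤ 2 ^ (2 * L) * ((1 / 2) ^ 3) ^ L := by
          rw [pow_mul (_ : ℝ) 51 L]
          gcongr
          · exact_mod_cast hL
          · norm_num
      _ = (1 / 2) ^ L := by
          rw [pow_mul, ← mul_pow]
          norm_num
  exact (pow_le_pow_iff_right_of_lt_one₀ (by norm_num) (by norm_num)).1 (hi.trans hbound)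

open Finset in
/-- Functions into a set with `q` elements that avoid the value `0` on `S`. -/
lemma card_filter_forall_ne {X : Type*} [Fintype X] [DecidableEq X] (q : ℕ) [NeZero q]
    (S : Finset X) :
    (#{g : X → Fin q | ∀ x ∈ S, g x ≠ 0} : ℝ) =
      (1 - 1 / q) ^ #S * Fintype.card (X → Fin q) := by
  have hset : ({g : X → Fin q | ∀ x ∈ S, g x ≠ 0} : Finset (X → Fin q)) =
      Fintype.piFinset fun x ↦ if x ∈ S then univ.erase 0 else univ := by
    ext g
    simp only [mem_filter, mem_univ, true_and, Fintype.mem_piFinset]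
    refine forall_congr' fun x ↦ ?_
    split_ifs with hx <;> simp [hx]
  have hq : (q : ℝ) ≠ 0 := by exact_mod_cast NeZero.ne q
  have hq1 : 1 ≤ q := NeZero.one_le
  have hfac : ∀ x, ((#(if x ∈ S then univ.erase (0 : Fin q) else univ) : ℕ) : ℝ) =
      (if x ∈ S then 1 - 1 / (q : ℝ) else 1) * q := by
    intro x
    split_ifs
    · rw [card_erase_of_mem (mem_univ _), card_univ, Fintype.card_fin, Nat.cast_sub hq1]
      field_simp
      simp
    · simp
  rw [hset, Fintype.card_piFinset, Nat.cast_prod, prod_congr rfl fun x _ ↦ hfac x,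
    prod_mul_distrib]
  simp

open Finset in
/-- A random subset of density `2 ^ (-(j + 1))` misses a set of size at most `2 ^ (j + 1)` and hits a
disjoint set of size at least `2 ^ j` with probability at least `1 / 12`. -/
lemma card_filter_miss_hit_ge {X : Type*} [Fintype X] [DecidableEq X] (j : ℕ) (S T : Finset X)
    (hST : Disjoint S T) (hS : #S ≤ 2 ^ (j + 1)) (hT : 2 ^ j ≤ #T) :
    (1 / 12 : ℝ) * Fintype.card (X → Fin (2 ^ (j + 1))) ≤
      #{g : X → Fin (2 ^ (j + 1)) | (∀ x ∈ S, g x ≠ 0) ∧ ∃ x ∈ T, g x = 0} := by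
  set F : Finset (X → Fin (2 ^ (j + 1))) := {g | (∀ x ∈ S, g x ≠ 0) ∧ ∃ x ∈ T, g x = 0}
  have hsplit : (#{g : X → Fin (2 ^ (j + 1)) | ∀ x ∈ S, g x ≠ 0} : ℝ) =
      #F + #{g : X → Fin (2 ^ (j + 1)) | ∀ x ∈ S ∪ T, g x ≠ 0} := by
    rw [← card_filter_add_card_filter_not (fun g ↦ ∃ x ∈ T, g x = 0), filter_filter,
      filter_filter]
    push_cast
    congr 3
    ext g
    simp [or_imp, forall_and]
  rw [card_filter_forall_ne, card_filter_forall_ne, card_union_of_disjoint hST,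
    pow_add (1 - 1 / ((2 ^ (j + 1) : ℕ) : ℝ)) #S] at hsplit
  set N : ℝ := (Fintype.card (X → Fin (2 ^ (j + 1))) : ℝ)
  have hN : 0 ≤ N := Nat.cast_nonneg _
  have hpow : (1 : ℝ) ≤ 2 ^ j := one_le_pow₀ (by norm_num)
  set q : ℝ := 1 / ((2 ^ (j + 1) : ℕ) : ℝ) with hq
  have hq' : q * 2 ^ j = 1 / 2 := by
    rw [hq]; push_cast; field_simp; ring
  have hq0 : 0 < q := by positivity
  have hq1 : q ≤ 1 / 2 := by nlinarith
  have hmiss : 1 / 4 ≤ (1 - q) ^ #S := by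
    have hb := one_add_mul_le_pow (a := -q) (by linarith) (2 ^ j)
    push_cast at hb
    have hb' : 1 / 2 ≤ (1 - q) ^ (2 ^ j) := by
      rw [sub_eq_add_neg]; linarith
    calc (1 / 4 : ℝ) = (1 / 2) ^ 2 := by norm_num
      _ ≤ ((1 - q) ^ (2 ^ j)) ^ 2 := by gcongr
      _ = (1 - q) ^ (2 ^ (j + 1)) := by rw [← pow_mul, pow_succ]
      _ ≤ (1 - q) ^ #S := pow_le_pow_of_le_one (by linarith) (by linarith) hS
  have hhit : (1 - q) ^ #T ≤ 2 / 3 := by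
    have hb := one_add_mul_le_pow (a := q) (by linarith) (2 ^ j)
    push_cast at hb
    have hb' : 3 / 2 ≤ (1 + q) ^ (2 ^ j) := by linarith
    have hprod : (1 - q) ^ (2 ^ j) * (1 + q) ^ (2 ^ j) ≤ 1 := by
      rw [← mul_pow]
      exact pow_le_one₀ (by nlinarith) (by nlinarith)
    have h0 : 0 ≤ (1 - q) ^ (2 ^ j) := pow_nonneg (by linarith) _
    have : (1 - q) ^ #T ≤ (1 - q) ^ (2 ^ j) :=
      pow_le_pow_of_le_one (by linarith) (by linarith) hT
    nlinarith
  have key : 1 / 12 ≤ (1 - q) ^ #S * (1 - (1 - q) ^ #T) := by nlinarith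
  nlinarith [mul_le_mul_of_nonneg_right key hN]

/-- A finite family of reals below `r > 0` stays below some nonnegative `r' < r`. -/
lemma Finset.exists_nonneg_lt_forall_le {X : Type*} (S : Finset X) (g : X → ℝ) {r : ℝ} (hr : 0 < r)
    (h : ∀ x ∈ S, g x < r) : ∃ r', 0 ≤ r' ∧ r' < r ∧ ∀ x ∈ S, g x ≤ r' := by
  classical
  induction S using Finset.induction_on with
  | empty => exact ⟨0, le_rfl, hr, by simp⟩
  | insert a S _ ih =>
    obtain ⟨r', h0, hlt, hle⟩ := ih fun x hx ↦ h x (Finset.mem_insert_of_mem hx)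
    refine ⟨max r' (g a), le_max_of_le_left h0, max_lt hlt (h a (Finset.mem_insert_self _ _)), ?_⟩
    intro x hx
    rcases Finset.mem_insert.1 hx with rfl | hx
    · exact le_max_right _ _
    · exact (hle x hx).trans (le_max_left _ _)

open Finset in
lemma isClosed_setOf_le_card_closedBall {X : Type*} [MetricSpace X] [Fintype X] (u : X) (k : ℕ) :
    IsClosed {r : ℝ | k ≤ #{x : X | dist x u ≤ r}} := by
  have hset : {r : ℝ | k ≤ #{x : X | dist x u ≤ r}} =
      ⋃ T ∈ {T : Finset X | k ≤ #T}, ⋂ x ∈ T, Set.Ici (dist x u) := by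
    ext r
    simp only [Set.mem_ofPred_eq, Set.mem_iUnion, Set.mem_iInter, Set.mem_Ici, exists_prop]
    refine ⟨fun h ↦ ⟨_, h, fun x hx ↦ (mem_filter.1 hx).2⟩, fun ⟨T, hT, h⟩ ↦ hT.trans ?_⟩
    exact card_le_card fun x hx ↦ mem_filter.2 ⟨mem_univ _, h x hx⟩
  rw [hset]
  exact (Set.toFinite _).isClosed_biUnion fun T _ ↦ isClosed_biInter fun x _ ↦ isClosed_Ici

open Finset in
/-- If a random set hits the closed `s`-ball around `v` and misses the open `r`-ball around `u`, its
distances to `u` and `v` differ by at least `r - s`. -/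
lemma card_filter_infDist_gap_ge {X : Type*} [MetricSpace X] [Fintype X] [DecidableEq X] (j : ℕ) (u v : X)
    (r s : ℝ) (hrs : r + s ≤ dist u v) (hu : #{x : X | dist x u < r} ≤ 2 ^ (j + 1))
    (hv : 2 ^ j ≤ #{x : X | dist x v ≤ s})
    [DecidablePred fun g : X → Fin (2 ^ (j + 1)) ↦
      r - s ≤ |Metric.infDist u {x | g x = 0} - Metric.infDist v {x | g x = 0}|] :
    (1 / 12 : ℝ) * Fintype.card (X → Fin (2 ^ (j + 1))) ≤
      #{g : X → Fin (2 ^ (j + 1)) |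
        r - s ≤ |Metric.infDist u {x | g x = 0} - Metric.infDist v {x | g x = 0}|} := by
  have hdisj : Disjoint ({x : X | dist x u < r} : Finset X)
      ({x : X | dist x v ≤ s} : Finset X) := by
    rw [Finset.disjoint_left]
    intro x hx hx'
    rw [mem_filter] at hx hx'
    have := dist_triangle_left u v x
    linarith [hx.2, hx'.2]
  have hcard := card_filter_miss_hit_ge j _ _ hdisj hu hv
  refine hcard.trans (Nat.cast_le.2 (card_le_card fun g hg ↦ ?_))
  simp only [mem_filter, mem_univ, true_and] at hg ⊢
  obtain ⟨hmiss, y, hy, hy0⟩ := hg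
  have hyA : y ∈ {x | g x = 0} := hy0
  have h1 : r ≤ Metric.infDist u {x | g x = 0} := by
    rw [Metric.le_infDist ⟨y, hyA⟩]
    intro x hx
    by_contra! hlt
    exact hmiss x (by rwa [dist_comm]) hx
  have h2 : Metric.infDist v {x | g x = 0} ≤ s :=
    (Metric.infDist_le_dist_of_mem hyA).trans (by rwa [dist_comm])
  exact le_trans (by linarith) (le_abs_self _)

open Finset in
open scoped Classical in
/-- The contributions of the `L` density scales telescope to a third of the distance. -/
lemma exists_scale_gaps {X : Type*} [MetricSpace X] [Fintype X] (L : ℕ)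
    (hL : Fintype.card X < 2 ^ L) (u v : X) :
    ∃ Δ : ℕ → ℝ, (∑ j ∈ range L, Δ j = dist u v / 3) ∧ (∀ j, 0 ≤ Δ j) ∧
      ∀ j, (1 / 12 : ℝ) * Fintype.card (X → Fin (2 ^ (j + 1))) ≤
        #{g : X → Fin (2 ^ (j + 1)) |
          Δ j ≤ |Metric.infDist u {x | g x = 0} - Metric.infDist v {x | g x = 0}|} := by
  set D := dist u v
  have hD0 : 0 ≤ D := dist_nonneg
  set S : ℕ → Set ℝ := fun j ↦ Set.Ici 0 ∩ (Set.Ici (D / 3) ∪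
    ({r : ℝ | 2 ^ j ≤ #{x : X | dist x u ≤ r}} ∩ {r : ℝ | 2 ^ j ≤ #{x : X | dist x v ≤ r}}))
  have hclosed : ∀ j, IsClosed (S j) := fun j ↦ isClosed_Ici.inter (isClosed_Ici.union
    ((isClosed_setOf_le_card_closedBall u _).inter (isClosed_setOf_le_card_closedBall v _)))
  have hmemD : ∀ j, D / 3 ∈ S j := fun j ↦ ⟨Set.mem_Ici.2 (by positivity),
    Or.inl (Set.mem_Ici.2 le_rfl)⟩
  have hbdd : ∀ j, BddBelow (S j) := fun j ↦ ⟨0, fun r hr ↦ hr.1⟩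
  set ρ : ℕ → ℝ := fun j ↦ sInf (S j)
  have hρ : ∀ j, ρ j ∈ S j := fun j ↦ (hclosed j).csInf_mem ⟨_, hmemD j⟩ (hbdd j)
  have hρle : ∀ j, ∀ r ∈ S j, ρ j ≤ r := fun j r hr ↦ csInf_le (hbdd j) hr
  have hρ0 : ∀ j, 0 ≤ ρ j := fun j ↦ (hρ j).1
  have hρD : ∀ j, ρ j ≤ D / 3 := fun j ↦ hρle j _ (hmemD j)
  have hmono : ∀ j, ρ j ≤ ρ (j + 1) := by
    intro j
    refine hρle j _ ⟨(hρ _).1, (hρ (j + 1)).2.imp id fun h ↦ ?_⟩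
    have hpow : 2 ^ j ≤ 2 ^ (j + 1) := Nat.pow_le_pow_right (by norm_num) j.le_succ
    exact ⟨hpow.trans h.1, hpow.trans h.2⟩
  have hzero : ρ 0 = 0 := by
    refine le_antisymm (hρle 0 0 ⟨Set.mem_Ici.2 le_rfl, Or.inr ⟨?_, ?_⟩⟩) (hρ0 0)
    · exact Finset.card_pos.2 ⟨u, by simp⟩
    · exact Finset.card_pos.2 ⟨v, by simp⟩
  have hlast : ρ L = D / 3 := by
    refine le_antisymm (hρD L) ?_
    rcases (hρ L).2 with h | h
    · exact h
    · exact absurd (h.1.trans (card_le_univ _)) (not_le.2 hL)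
  refine ⟨fun j ↦ ρ (j + 1) - ρ j, by rw [sum_range_sub, hzero, hlast, sub_zero],
    fun j ↦ sub_nonneg.2 (hmono j), fun j ↦ ?_⟩
  rcases (hmono j).eq_or_lt with heq | hlt
  · have htriv : ∀ g : X → Fin (2 ^ (j + 1)), ρ (j + 1) - ρ j ≤
        |Metric.infDist u {x | g x = 0} - Metric.infDist v {x | g x = 0}| := by
      intro g
      rw [← heq, sub_self]
      exact abs_nonneg _
    rw [filter_true_of_mem fun g _ ↦ htriv g, card_univ]
    have : (0 : ℝ) ≤ Fintype.card (X → Fin (2 ^ (j + 1))) := Nat.cast_nonneg _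
    linarith
  · have hballs : 2 ^ j ≤ #{x : X | dist x u ≤ ρ j} ∧ 2 ^ j ≤ #{x : X | dist x v ≤ ρ j} := by
      rcases (hρ j).2 with h | h
      · exact absurd (hlt.trans_le (hρD _)) (not_lt.2 h)
      · exact h
    have hsum : ρ (j + 1) + ρ j ≤ D := by linarith [hρD j, hρD (j + 1)]
    by_cases hu : #{x : X | dist x u < ρ (j + 1)} ≤ 2 ^ (j + 1)
    · exact card_filter_infDist_gap_ge j u v _ _ hsum hu hballs.2
    by_cases hv : #{x : X | dist x v < ρ (j + 1)} ≤ 2 ^ (j + 1)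
    · have := card_filter_infDist_gap_ge j v u _ _ (by rwa [dist_comm v u]) hv hballs.1
      simpa only [abs_sub_comm (Metric.infDist v _)] using this
    exfalso
    have hpos : 0 < ρ (j + 1) := (hρ0 j).trans_lt hlt
    obtain ⟨a, ha0, ha, hau⟩ := Finset.exists_nonneg_lt_forall_le
      {x : X | dist x u < ρ (j + 1)} (fun x ↦ dist x u) hpos (fun x hx ↦ (mem_filter.1 hx).2)
    obtain ⟨b, -, hb, hbv⟩ := Finset.exists_nonneg_lt_forall_le
      {x : X | dist x v < ρ (j + 1)} (fun x ↦ dist x v) hpos (fun x hx ↦ (mem_filter.1 hx).2)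
    refine (max_lt ha hb).not_ge (hρle (j + 1) _ ⟨le_max_of_le_left ha0, Or.inr ⟨?_, ?_⟩⟩)
    · exact (not_le.1 hu).le.trans (card_le_card fun x hx ↦
        mem_filter.2 ⟨mem_univ _, (hau x hx).trans (le_max_left _ _)⟩)
    · exact (not_le.1 hv).le.trans (card_le_card fun x hx ↦
        mem_filter.2 ⟨mem_univ _, (hbv x hx).trans (le_max_right _ _)⟩)

/-- **Bourgain's embedding.** There is an absolute constant `C > 0` such that every finite
metric space `(X, ρ)` with `|X| = n ≥ 2` embeds into `ℝ^t` with the `ℓ₁` norm, for some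
`t ≤ C (log₂ n)²`, non-contractively and with expansion at most `C log₂ n`. -/
theorem bourgain_embedding :
    ∃ C : ℝ, 0 < C ∧
      ∀ (X : Type) [MetricSpace X] [Fintype X], 2 ≤ Fintype.card X →
        ∃ (t : ℕ) (f : X → Fin t → ℝ),
          (t : ℝ) ≤ C * (Real.logb 2 (Fintype.card X)) ^ 2 ∧
          ∀ u v : X,
            dist u v ≤ ∑ i, |f u i - f v i| ∧
            ∑ i, |f u i - f v i| ≤ C * Real.logb 2 (Fintype.card X) * dist u v := by
  classical
  refine ⟨306, by norm_num, fun X _ _ hX ↦ ?_⟩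
  set n := Fintype.card X
  set L := Nat.log 2 n + 1 with hLdef
  have hnL : n < 2 ^ L := Nat.lt_pow_succ_log_self (by norm_num) n
  have hlog1 : 1 ≤ Real.logb 2 n := by
    rw [Real.le_logb_iff_rpow_le (by norm_num) (by positivity)]
    simpa using (by exact_mod_cast hX : (2 : ℝ) ≤ n)
  have hLlog : (L : ℝ) ≤ 2 * Real.logb 2 n := by
    have : (Nat.log 2 n : ℝ) ≤ Real.logb 2 n := by exact_mod_cast Real.natLog_le_logb n 2
    rw [hLdef]
    push_cast
    linarith
  have hL0 : (0 : ℝ) < L := by rw [hLdef]; positivity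
  choose Δ hΔsum hΔ0 hΔ using fun u v : X ↦ exists_scale_gaps L hnL u v
  have hpairs : Fintype.card (X × X) ≤ 2 ^ (2 * L) := by
    rw [Fintype.card_prod, two_mul, pow_add]
    exact Nat.mul_le_mul hnL.le hnL.le
  choose w hw using fun j : ℕ ↦ exists_samples_card_ge
    (fun (e : X × X) (g : X → Fin (2 ^ (j + 1))) ↦ Δ e.1 e.2 j ≤
      |Metric.infDist e.1 {x | g x = 0} - Metric.infDist e.2 {x | g x = 0}|)
    (fun e ↦ hΔ e.1 e.2 j) L hpairs
  set φ : X → Fin L → Fin (51 * L) → ℝ := fun u j k ↦ Metric.infDist u {x | w j k x = 0}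
  have hscale : ∀ u v : X, ∀ j k, |3 / L * φ u j k - 3 / L * φ v j k| =
      3 / L * |φ u j k - φ v j k| := fun u v j k ↦ by
    rw [← mul_sub, abs_mul, abs_of_pos (by positivity)]
  have hsum : ∀ u v : X, ∑ i : Fin (L * (51 * L)),
      |3 / L * φ u (finProdFinEquiv.symm i).1 (finProdFinEquiv.symm i).2 -
        3 / L * φ v (finProdFinEquiv.symm i).1 (finProdFinEquiv.symm i).2| =
      3 / L * ∑ j, ∑ k, |φ u j k - φ v j k| := fun u v ↦ by
    rw [Equiv.sum_comp finProdFinEquiv.symm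
      (fun e ↦ |3 / L * φ u e.1 e.2 - 3 / L * φ v e.1 e.2|), Fintype.sum_prod_type]
    simp only [hscale, Finset.mul_sum]
  refine ⟨L * (51 * L), fun u i ↦
    3 / L * φ u (finProdFinEquiv.symm i).1 (finProdFinEquiv.symm i).2, ?_, fun u v ↦ ?_⟩
  · push_cast
    nlinarith
  rw [hsum]
  constructor
  · have hj : ∀ j : Fin L, L * Δ u v j ≤ ∑ k, |φ u j k - φ v j k| := fun j ↦ by
      calc L * Δ u v j
          ≤ (Finset.univ.filter fun k ↦ Δ u v j ≤ |φ u j k - φ v j k|).card * Δ u v j :=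
            mul_le_mul_of_nonneg_right (Nat.cast_le.2 (hw j (u, v))) (hΔ0 u v j)
        _ ≤ ∑ k with Δ u v j ≤ |φ u j k - φ v j k|, |φ u j k - φ v j k| := by
            rw [← nsmul_eq_mul]
            exact Finset.card_nsmul_le_sum _ _ _ fun k hk ↦ (Finset.mem_filter.1 hk).2
        _ ≤ _ := Finset.sum_le_sum_of_subset_of_nonneg (Finset.filter_subset _ _)
            fun _ _ _ ↦ abs_nonneg _
    calc dist u v = 3 / L * ∑ j : Fin L, L * Δ u v j := by
          rw [← Finset.mul_sum, Fin.sum_univ_eq_sum_range (Δ u v) L, hΔsum]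
          field_simp
      _ ≤ _ := by gcongr with j; exact hj j
  · have hk : ∀ j k, |φ u j k - φ v j k| ≤ dist u v := fun j k ↦ by
      rw [← Real.dist_eq]
      simpa using (Metric.lipschitz_infDist_pt {x | w j k x = 0}).dist_le_mul u v
    calc 3 / L * ∑ j, ∑ k, |φ u j k - φ v j k|
        ≤ 3 / L * ∑ _j : Fin L, ∑ _k : Fin (51 * L), dist u v := by
          gcongr with j _ k _
          exact hk j k
      _ = 153 * L * dist u v := by
          simp only [Finset.sum_const, Finset.card_univ, Fintype.card_fin, nsmul_eq_mul]
          push_cast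
          field_simp
          ring
      _ ≤ 306 * Real.logb 2 n * dist u v :=
          mul_le_mul_of_nonneg_right (by linarith) dist_nonneg
end

section
/- There is an absolute constant C > 0 such that the following holds. Let X be a finite set with |X| = n ≥ 2, let γ ≥ 1, and let ξ : X × X → [0,∞) be a symmetric function with ξ(x,x) = 0 for which there exists a metric ξ* on X with ξ*(u,v) ≤ ξ(u,v) ≤ γ·ξ*(u,v) for all u,v ∈ X. Then there exist a natural number t ≤ C·(log₂ n)² and a map f : X → ℝ^t such that for all u, v ∈ X: ξ(u,v) ≤ ‖f(u) − f(v)‖₁ ≤ C·γ·(log₂ n)·ξ(u,v). -/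
open Finset

/-- The functions avoiding the value `y` on `B` make up a fraction `(1 - 1 / |Y|) ^ |B|` of all
functions `X → Y`. -/
lemma card_filter_forall_mem_ne {X Y : Type} [Fintype X] [DecidableEq X] [Fintype Y]
    [DecidableEq Y] (y : Y) (B : Finset X) :
    (#{φ : X → Y | ∀ x ∈ B, φ x ≠ y} : ℝ) =
      Fintype.card (X → Y) * (1 - 1 / (Fintype.card Y : ℝ)) ^ #B := by
  have hY : (Fintype.card Y : ℝ) ≠ 0 := by
    have : 0 < Fintype.card Y := Fintype.card_pos_iff.2 ⟨y⟩
    positivity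
  have hY1 : 1 ≤ Fintype.card Y := Fintype.card_pos_iff.2 ⟨y⟩
  have h : ({φ : X → Y | ∀ x ∈ B, φ x ≠ y} : Finset (X → Y)) =
      Fintype.piFinset fun x => if x ∈ B then ({y}ᶜ : Finset Y) else univ := by
    ext φ
    simp only [mem_filter, mem_univ, true_and, Fintype.mem_piFinset]
    refine forall_congr' fun x => ?_
    by_cases hx : x ∈ B <;> simp [hx]
  rw [h, Fintype.card_piFinset, Fintype.card_fun, Nat.cast_prod, Nat.cast_pow, ← card_univ (α := X),
    ← prod_const, ← prod_const (s := B), ← prod_ite_mem_eq (s := B), ← prod_mul_distrib]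
  refine prod_congr rfl fun x _ => ?_
  by_cases hx : x ∈ B
  · simp only [hx, if_true, card_compl, card_singleton]
    rw [Nat.cast_sub hY1]
    field_simp
    simp
  · simp [hx]

/-- A random set of density `1 / (2 M)` misses `B` and meets `G` with probability at least `1/12`,
if `B` has at most `2 M` points and `G` has at least `M` points. -/
lemma card_avoid_and_hit {X Y : Type} [Fintype X] [DecidableEq X] [Fintype Y]
    [DecidableEq Y] (y : Y) {M : ℕ} (hM : 1 ≤ M) (hY : Fintype.card Y = 2 * M)
    {B G : Finset X} (hBG : Disjoint B G) (hB : #B ≤ 2 * M) (hG : M ≤ #G) :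
    (1 / 12 : ℝ) * Fintype.card (X → Y) ≤
      #{φ : X → Y | (∀ x ∈ B, φ x ≠ y) ∧ ∃ x ∈ G, φ x = y} := by
  have hsplit : #{φ : X → Y | ∀ x ∈ B, φ x ≠ y} =
      #{φ : X → Y | (∀ x ∈ B, φ x ≠ y) ∧ ∃ x ∈ G, φ x = y} +
        #{φ : X → Y | ∀ x ∈ B ∪ G, φ x ≠ y} := by
    rw [← card_filter_add_card_filter_not (s := {φ : X → Y | ∀ x ∈ B, φ x ≠ y})
      (fun φ => ∃ x ∈ G, φ x = y), filter_filter, filter_filter]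
    congr 2
    ext φ
    simp only [mem_filter, mem_univ, true_and, mem_union, not_exists, not_and]
    constructor
    · rintro ⟨h1, h2⟩ x (hx | hx)
      · exact h1 x hx
      · exact h2 x hx
    · exact fun h => ⟨fun x hx => h x (.inl hx), fun x hx => h x (.inr hx)⟩
  have hsplit' := congrArg (Nat.cast : ℕ → ℝ) hsplit
  rw [Nat.cast_add, card_filter_forall_mem_ne, card_filter_forall_mem_ne,
    card_union_of_disjoint hBG, pow_add, hY] at hsplit'
  have hM' : (1 : ℝ) ≤ M := by exact_mod_cast hM
  set q : ℝ := 1 - 1 / ((2 * M : ℕ) : ℝ) with hq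
  have hinv : 1 / ((2 * M : ℕ) : ℝ) ≤ 1 / 2 := by
    push_cast
    exact one_div_le_one_div_of_le (by norm_num) (by linarith)
  have hinv0 : 0 < 1 / ((2 * M : ℕ) : ℝ) := by
    push_cast
    positivity
  have hq0 : 0 ≤ q := by linarith
  have hq1 : q ≤ 1 := by linarith
  have hMinv : (M : ℝ) * (1 / ((2 * M : ℕ) : ℝ)) = 1 / 2 := by
    push_cast
    field_simp
  have hlow : 1 / 4 ≤ q ^ #B := by
    have h1 : 1 / 2 ≤ q ^ M := by
      have := one_add_mul_le_pow (a := -(1 / ((2 * M : ℕ) : ℝ))) (by linarith) M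
      rw [← sub_eq_add_neg, ← hq] at this
      linarith
    calc (1 / 4 : ℝ) = (1 / 2) ^ 2 := by norm_num
      _ ≤ (q ^ M) ^ 2 := by gcongr
      _ = q ^ (2 * M) := by rw [← pow_mul, mul_comm]
      _ ≤ q ^ #B := pow_le_pow_of_le_one hq0 hq1 hB
  have hupp : q ^ #G ≤ 2 / 3 := by
    calc q ^ #G ≤ q ^ M := pow_le_pow_of_le_one hq0 hq1 hG
      _ ≤ (Real.exp (-(1 / ((2 * M : ℕ) : ℝ)))) ^ M := by
        gcongr
        have := Real.add_one_le_exp (-(1 / ((2 * M : ℕ) : ℝ)))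
        linarith
      _ = (Real.exp (1 / 2))⁻¹ := by
        rw [← Real.exp_nat_mul, mul_neg, hMinv, Real.exp_neg]
      _ ≤ (3 / 2 : ℝ)⁻¹ := by
        gcongr
        have := Real.add_one_le_exp (1 / 2 : ℝ)
        linarith
      _ = 2 / 3 := by norm_num
  have hkey : 1 / 12 ≤ q ^ #B * (1 - q ^ #G) := by nlinarith
  have := mul_le_mul_of_nonneg_right hkey (Nat.cast_nonneg (α := ℝ) (Fintype.card (X → Y)))
  linarith

/-- If every test succeeds with probability at least `p`, then some `m` samples leave the
exponential potential counting the successes of each test below its expectation. -/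
lemma exists_samples_sum_prod_le {P Ω : Type} [Fintype P] [Fintype Ω] [Nonempty Ω]
    (good : P → Ω → Prop) [∀ a, DecidablePred (good a)] {p : ℝ}
    (hp : ∀ a, p * Fintype.card Ω ≤ #{ω | good a ω}) (m : ℕ) (hp1 : p ≤ 1) :
    ∃ ω : Fin m → Ω, ∑ a, ∏ i, (if good a (ω i) then (1 / 2 : ℝ) else 1) ≤
      Fintype.card P * (1 - p / 2) ^ m := by
  induction m with
  | zero => exact ⟨Fin.elim0, by simp⟩
  | succ m ih =>
    obtain ⟨ω, hω⟩ := ih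
    set W : P → ℝ := fun a => ∏ i, (if good a (ω i) then (1 / 2 : ℝ) else 1) with hW
    have hW0 : ∀ a, 0 ≤ W a := fun a => prod_nonneg fun i _ => by split_ifs <;> norm_num
    have havg : ∑ ω₀ : Ω, ∑ a, (if good a ω₀ then (1 / 2 : ℝ) else 1) * W a ≤
        ∑ _ω₀ : Ω, (1 - p / 2) * ∑ a, W a := by
      rw [sum_comm, sum_const, card_univ, nsmul_eq_mul, mul_sum, mul_sum]
      refine sum_le_sum fun a _ => ?_
      rw [← sum_mul, ← mul_assoc]
      refine mul_le_mul_of_nonneg_right ?_ (hW0 a)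
      have : ∀ ω₀ : Ω, (if good a ω₀ then (1 / 2 : ℝ) else 1) =
          1 - 1 / 2 * (if good a ω₀ then 1 else 0) := fun ω₀ => by split_ifs <;> norm_num
      simp_rw [this]
      rw [sum_sub_distrib, ← mul_sum, sum_boole]
      simp only [sum_const, card_univ, nsmul_eq_mul, mul_one]
      linarith [hp a]
    obtain ⟨ω₀, -, h₀⟩ := exists_le_of_sum_le univ_nonempty havg
    refine ⟨Fin.cons ω₀ ω, ?_⟩
    simp only [Fin.prod_univ_succ, Fin.cons_zero, Fin.cons_succ]
    refine h₀.trans ?_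
    rw [pow_succ]
    nlinarith

/-- If each of at most `4 ^ k` tests succeeds with probability at least `1/12`, then some
`17 (2 k + L)` samples make each test succeed at least `L` times. -/
lemma exists_samples_le_card_good {P Ω : Type} [Fintype P] [Fintype Ω] [Nonempty Ω]
    (good : P → Ω → Prop) [∀ a, DecidablePred (good a)]
    (hp : ∀ a, (1 / 12 : ℝ) * Fintype.card Ω ≤ #{ω | good a ω}) {k L : ℕ}
    (hP : Fintype.card P ≤ 4 ^ k) :
    ∃ ω : Fin (17 * (2 * k + L)) → Ω, ∀ a, L ≤ #{i | good a (ω i)} := by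
  obtain ⟨ω, hω⟩ := exists_samples_sum_prod_le good hp (17 * (2 * k + L)) (by norm_num)
  refine ⟨ω, fun a => ?_⟩
  have h1 := (single_le_sum (f := fun a => ∏ i, (if good a (ω i) then (1 / 2 : ℝ) else 1))
    (fun a _ => prod_nonneg fun i _ => by split_ifs <;> norm_num) (mem_univ a)).trans hω
  simp only [prod_ite, prod_const, one_pow, mul_one] at h1
  have h2 : (Fintype.card P : ℝ) * (1 - 1 / 12 / 2) ^ (17 * (2 * k + L)) ≤ (1 / 2) ^ L := by
    have hP' : (Fintype.card P : ℝ) ≤ 4 ^ k := by exact_mod_cast hP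
    calc (Fintype.card P : ℝ) * (1 - 1 / 12 / 2) ^ (17 * (2 * k + L))
        ≤ 4 ^ k * (1 / 2) ^ (2 * k + L) := by
          rw [pow_mul]
          gcongr
          norm_num
      _ = (1 / 2) ^ L := by
          rw [pow_add, pow_mul, ← mul_assoc, ← mul_pow]
          norm_num
  exact (pow_le_pow_iff_right_of_lt_one₀ (by norm_num) (by norm_num)).1 (h1.trans h2)

section Radii

variable {X : Type} [Fintype X] [PseudoMetricSpace X]

/-- The largest radius, capped at `R`, at which one of the open balls around `u` and `v` has fewer
than `K` points. -/
lemma exists_critical_radius (u v : X) {R : ℝ} (hR : 0 ≤ R) {K : ℕ} (hK : 0 < K) :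
    ∃ r, r ≤ R ∧ (#{x | dist u x < r} < K ∨ #{x | dist v x < r} < K) ∧
      (r = R ∨ (K ≤ #{x | dist u x ≤ r} ∧ K ≤ #{x | dist v x ≤ r})) := by
  classical
  set S : Finset ℝ := insert 0 (insert R (univ.image (dist u) ∪ univ.image (dist v))) with hS
  have hmem : ∀ w x, (w = u ∨ w = v) → dist w x ∈ S := by
    rintro w x (rfl | rfl) <;> simp [hS]
  set T := S.filter fun r => r ≤ R ∧ (#{x | dist u x < r} < K ∨ #{x | dist v x < r} < K) with hT
  have hT0 : T.Nonempty := ⟨0, by simp [hT, hS, hR, hK, not_lt.2 dist_nonneg]⟩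
  obtain ⟨r, hrT, hmax⟩ := T.exists_max_image id hT0
  obtain ⟨-, hrR, hr⟩ := mem_filter.1 hrT
  refine ⟨r, hrR, hr, ?_⟩
  rcases hrR.eq_or_lt with h | hlt
  · exact .inl h
  right
  by_contra hcon
  have hne : (S.filter (r < ·)).Nonempty := ⟨R, by simp [hS, hlt]⟩
  obtain ⟨s, hsS, hmin⟩ := (S.filter (r < ·)).exists_min_image id hne
  obtain ⟨hsS, hrs⟩ := mem_filter.1 hsS
  have hsub : ∀ w, (w = u ∨ w = v) →
      #{x | dist w x < s} ≤ #{x | dist w x ≤ r} := fun w hw => by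
    refine card_le_card fun x hx => ?_
    simp only [mem_filter, mem_univ, true_and] at hx ⊢
    by_contra! hlt'
    exact absurd (hmin _ (mem_filter.2 ⟨hmem w x hw, hlt'⟩)) (not_le.2 hx)
  have hsT : s ∈ T := by
    refine mem_filter.2 ⟨hsS, hmin R (by simp [hS, hlt]), ?_⟩
    rw [not_and_or, not_le, not_le] at hcon
    exact hcon.imp (hsub u (.inl rfl)).trans_lt (hsub v (.inr rfl)).trans_lt
  exact absurd (hmax s hsT) (not_le.2 hrs)

/-- A sequence of radii from `0` to half the distance of `u` and `v` such that, at each step where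
the radius grows, one point has a small open ball of the larger radius while the other has a large
closed ball of the smaller radius. -/
lemma exists_radii (u v : X) {L : ℕ} (hL : Fintype.card X < 2 ^ (L + 1)) :
    ∃ ρ : ℕ → ℝ, ρ 0 ≤ 0 ∧ ρ L = dist u v / 2 ∧ (∀ j, ρ j ≤ dist u v / 2) ∧
      ∀ j, ρ j < ρ (j + 1) →
        (#{x | dist u x < ρ (j + 1)} ≤ 2 * 2 ^ j ∧ 2 ^ j ≤ #{x | dist v x ≤ ρ j}) ∨
        (#{x | dist v x < ρ (j + 1)} ≤ 2 * 2 ^ j ∧ 2 ^ j ≤ #{x | dist u x ≤ ρ j}) := by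
  have hR : 0 ≤ dist u v / 2 := by positivity
  choose ρ hρR hρ hρ' using fun j : ℕ =>
    exists_critical_radius u v hR (K := 2 ^ j) (by positivity)
  refine ⟨ρ, ?_, ?_, hρR, fun j hj => ?_⟩
  · by_contra! hpos
    rcases hρ 0 with h | h <;> rw [pow_zero, Nat.lt_one_iff, card_eq_zero] at h
    · have : u ∈ ({x | dist u x < ρ 0} : Finset X) := by simpa using hpos
      simp [h] at this
    · have : v ∈ ({x | dist v x < ρ 0} : Finset X) := by simpa using hpos
      simp [h] at this
  · by_contra hne
    have hlt := (hρR L).lt_of_ne hne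
    obtain ⟨h1, h2⟩ := (hρ' L).resolve_left hne
    classical
    have hdis : Disjoint ({x | dist u x ≤ ρ L} : Finset X) ({x | dist v x ≤ ρ L} : Finset X) := by
      refine disjoint_left.2 fun x hx hx' => ?_
      simp only [mem_filter, mem_univ, true_and] at hx hx'
      linarith [dist_triangle_right u v x]
    have := card_le_univ (({x | dist u x ≤ ρ L} : Finset X) ∪
      ({x | dist v x ≤ ρ L} : Finset X))
    rw [card_union_of_disjoint hdis] at this
    rw [pow_succ] at hL
    omega
  · obtain ⟨h1, h2⟩ := (hρ' j).resolve_left (hj.trans_le (hρR _)).ne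
    have := hρ (j + 1)
    rw [pow_succ, mul_comm] at this
    exact this.imp (fun h => ⟨h.le, h2⟩) (fun h => ⟨h.le, h1⟩)

/-- A random set of density `1 / (2 M)` separates the distances of `u` and `v` to it by `s - r`
with probability at least `1/12`. -/
lemma card_infDist_separated {Y : Type} [Fintype Y] [DecidableEq Y] (y : Y) {M : ℕ} (hM : 1 ≤ M)
    (hY : Fintype.card Y = 2 * M) (u v : X) {r s : ℝ} (hrs : r + s ≤ dist u v)
    (hB : #{x | dist u x < s} ≤ 2 * M) (hG : M ≤ #{x | dist v x ≤ r}) [DecidableEq X]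
    [DecidablePred fun φ : X → Y => s - r ≤
        |Metric.infDist u {x | φ x = y} - Metric.infDist v {x | φ x = y}|] :
    (1 / 12 : ℝ) * Fintype.card (X → Y) ≤
      #{φ : X → Y | s - r ≤
        |Metric.infDist u {x | φ x = y} - Metric.infDist v {x | φ x = y}|} := by
  have hdis : Disjoint ({x | dist u x < s} : Finset X) ({x | dist v x ≤ r} : Finset X) := by
    refine disjoint_left.2 fun x hx hx' => ?_
    simp only [mem_filter, mem_univ, true_and] at hx hx'
    linarith [dist_triangle_right u v x]
  refine (card_avoid_and_hit y hM hY hdis hB hG).trans ?_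
  gcongr with φ
  rintro ⟨hmiss, x, hx, hxy⟩
  have h1 : s ≤ Metric.infDist u {x | φ x = y} := by
    refine (Metric.le_infDist ⟨x, hxy⟩).2 fun {z} hz => ?_
    by_contra! hlt
    exact hmiss z (by simpa using hlt) hz
  have h2 : Metric.infDist v {x | φ x = y} ≤ r :=
    (Metric.infDist_le_dist_of_mem (s := {x | φ x = y}) hxy).trans (by simpa using hx)
  exact le_trans (by linarith) (le_abs_self _)

/-- **Bourgain's embedding theorem**, unnormalized and with quadratically many coordinates. -/
theorem exists_l1_embedding {L : ℕ} (hL1 : 1 ≤ L) (hL : Fintype.card X < 2 ^ (L + 1)) :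
    ∃ g : X → Fin L × Fin (85 * L) → ℝ,
      (∀ u v, L * (dist u v / 2) ≤ ∑ i, |g u i - g v i|) ∧
      ∀ u v i, |g u i - g v i| ≤ dist u v := by
  classical
  choose ρ hρ0 hρL hρR hρ using fun u v : X => exists_radii u v hL
  have hscale : ∀ j : ℕ, ∃ A : Fin (17 * (2 * (2 * L) + L)) → Set X, ∀ a : X × X,
      L ≤ #{i | ρ a.1 a.2 (j + 1) - ρ a.1 a.2 j ≤
        |Metric.infDist a.1 (A i) - Metric.infDist a.2 (A i)|} := fun j => by
    let Y := Fin (2 * 2 ^ j)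
    let y : Y := ⟨0, by positivity⟩
    have : Nonempty (X → Y) := ⟨fun _ => y⟩
    have hP : Fintype.card (X × X) ≤ 4 ^ (2 * L) := by
      calc Fintype.card (X × X) = Fintype.card X * Fintype.card X := Fintype.card_prod _ _
        _ ≤ 2 ^ (L + 1) * 2 ^ (L + 1) := Nat.mul_le_mul hL.le hL.le
        _ = 4 ^ (L + 1) := by rw [← mul_pow]; norm_num
        _ ≤ 4 ^ (2 * L) := Nat.pow_le_pow_right (by norm_num) (by omega)
    let good : X × X → (X → Y) → Prop := fun a φ => ρ a.1 a.2 (j + 1) - ρ a.1 a.2 j ≤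
      |Metric.infDist a.1 {x | φ x = y} - Metric.infDist a.2 {x | φ x = y}|
    have hp : ∀ a, (1 / 12 : ℝ) * Fintype.card (X → Y) ≤ #{φ | good a φ} := fun a => by
      obtain ⟨u, v⟩ := a
      dsimp only [good]
      have hY : Fintype.card Y = 2 * 2 ^ j := Fintype.card_fin _
      have hsum : ρ u v j + ρ u v (j + 1) ≤ dist u v := by
        linarith [hρR u v j, hρR u v (j + 1)]
      rcases le_or_gt (ρ u v (j + 1)) (ρ u v j) with hle | hlt
      · rw [filter_true_of_mem fun φ _ => (sub_nonpos.2 hle).trans (abs_nonneg _), card_univ]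
        linarith [Nat.cast_nonneg (α := ℝ) (Fintype.card (X → Y))]
      · rcases hρ u v j hlt with ⟨hB, hG⟩ | ⟨hB, hG⟩
        · exact card_infDist_separated y Nat.one_le_two_pow hY u v hsum hB hG
        · simp_rw [abs_sub_comm (Metric.infDist u _)]
          exact card_infDist_separated y Nat.one_le_two_pow hY v u (by rwa [dist_comm]) hB hG
    obtain ⟨φ, hφ⟩ := exists_samples_le_card_good good hp (L := L) hP
    exact ⟨fun i => {x | φ i x = y}, hφ⟩
  choose A hA using hscale
  have hcard : 85 * L = 17 * (2 * (2 * L) + L) := by ring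
  refine ⟨fun u i => Metric.infDist u (A i.1 (Fin.cast hcard i.2)), fun u v => ?_,
    fun u v i => ?_⟩
  · have htel : dist u v / 2 ≤ ∑ j : Fin L, (ρ u v (j + 1) - ρ u v j) := by
      rw [Fin.sum_univ_eq_sum_range (fun j => ρ u v (j + 1) - ρ u v j), sum_range_sub, hρL]
      linarith [hρ0 u v]
    rw [Fintype.sum_prod_type]
    refine (mul_le_mul_of_nonneg_left htel (Nat.cast_nonneg L)).trans ?_
    rw [mul_sum]
    refine sum_le_sum fun j _ => ?_
    refine le_of_le_of_eq ?_ ((finCongr hcard).sum_comp fun i =>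
      |Metric.infDist u (A j i) - Metric.infDist v (A j i)|).symm
    rcases le_or_gt (ρ u v (j + 1) - ρ u v j) 0 with hle | hpos
    · exact (mul_nonpos_of_nonneg_of_nonpos (Nat.cast_nonneg L) hle).trans
        (sum_nonneg fun _ _ => abs_nonneg _)
    · refine (mul_le_mul_of_nonneg_right (Nat.cast_le.2 (hA j (u, v))) hpos.le).trans ?_
      rw [← nsmul_eq_mul]
      refine (card_nsmul_le_sum _ _ _ fun i hi => (mem_filter.1 hi).2).trans ?_
      exact sum_le_sum_of_subset_of_nonneg (filter_subset _ _) fun _ _ _ => abs_nonneg _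
  · simpa [Real.dist_eq] using (Metric.lipschitz_infDist_pt (A i.1 (Fin.cast hcard i.2))).dist_le_mul u v

end Radii


/-- There is an absolute constant `C > 0` such that any `γ`-near metric `ξ` on an `n`-point
set (`n ≥ 2`) embeds into `ℝ^t` with the `ℓ₁` norm, for some `t ≤ C (log₂ n)²`,
non-contractively and with expansion at most `C·γ·log₂ n`. -/
theorem near_metric_l1_embedding :
    ∃ C : ℝ, 0 < C ∧
      ∀ (X : Type) [Fintype X], 2 ≤ Fintype.card X →
      ∀ (γ : ℝ), 1 ≤ γ →
      ∀ (ξ : X → X → ℝ),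
        (∀ u v, 0 ≤ ξ u v) →
        (∀ u v, ξ u v = ξ v u) →
        (∀ u, ξ u u = 0) →
        (∃ ξstar : X → X → ℝ,
          (∀ u v, ξstar u v = ξstar v u) ∧
          (∀ u v, ξstar u v = 0 ↔ u = v) ∧
          (∀ u v w, ξstar u w ≤ ξstar u v + ξstar v w) ∧
          (∀ u v, ξstar u v ≤ ξ u v ∧ ξ u v ≤ γ * ξstar u v)) →
        ∃ (t : ℕ) (f : X → Fin t → ℝ),
          (t : ℝ) ≤ C * (Real.logb 2 (Fintype.card X)) ^ 2 ∧
          ∀ u v : X,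
            ξ u v ≤ ∑ i, |f u i - f v i| ∧
            ∑ i, |f u i - f v i| ≤ C * γ * Real.logb 2 (Fintype.card X) * ξ u v := by
  refine ⟨170, by norm_num, ?_⟩
  rintro X _ hn γ hγ ξ - - - ⟨d, hsymm, hzero, htri, hd⟩
  let _ : PseudoMetricSpace X :=
    { dist := d
      dist_self := fun u => (hzero u u).2 rfl
      dist_comm := hsymm
      dist_triangle := htri }
  set L := Nat.log 2 (Fintype.card X) with hLdef
  have hL1 : 1 ≤ L := Nat.log_pos (by norm_num) hn
  obtain ⟨g, hlow, hupp⟩ := exists_l1_embedding (X := X) hL1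
    (Nat.lt_pow_succ_log_self (by norm_num) _)
  have hL0 : (0 : ℝ) < L := by exact_mod_cast hL1
  have hlog : (L : ℝ) ≤ Real.logb 2 (Fintype.card X) := by
    simpa using Real.natLog_le_logb (Fintype.card X) 2
  let e : Fin (L * (85 * L)) ≃ Fin L × Fin (85 * L) := finProdFinEquiv.symm
  refine ⟨L * (85 * L), fun u i => γ * (2 / L) * g u (e i), ?_, fun u v => ?_⟩
  · push_cast
    nlinarith
  have hlog0 : 0 ≤ Real.logb 2 (Fintype.card X) := hL0.le.trans hlog
  obtain ⟨hd1, hd2⟩ := hd u v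
  have hd0 : 0 ≤ d u v := dist_nonneg (x := u) (y := v)
  have hc : 0 ≤ γ * (2 / L) := by positivity
  have hsum : ∑ i, |γ * (2 / L) * g u (e i) - γ * (2 / L) * g v (e i)| =
      γ * (2 / L) * ∑ i, |g u i - g v i| := by
    rw [Finset.mul_sum, ← e.sum_comp]
    exact Finset.sum_congr rfl fun i _ => by rw [← mul_sub, abs_mul, abs_of_nonneg hc]
  rw [hsum]
  constructor
  · calc ξ u v ≤ γ * d u v := hd2
      _ = γ * (2 / L) * (L * (d u v / 2)) := by field_simp
      _ ≤ _ := mul_le_mul_of_nonneg_left (hlow u v) hc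
  · calc γ * (2 / L) * ∑ i, |g u i - g v i|
        ≤ γ * (2 / L) * ∑ _i : Fin L × Fin (85 * L), d u v :=
          mul_le_mul_of_nonneg_left (Finset.sum_le_sum fun i _ => hupp u v i) hc
      _ = 170 * γ * L * d u v := by
          simp only [Finset.sum_const, Finset.card_univ, Fintype.card_prod, Fintype.card_fin,
            nsmul_eq_mul, Nat.cast_mul, Nat.cast_ofNat]
          field_simp
          ring
      _ ≤ 170 * γ * Real.logb 2 (Fintype.card X) * ξ u v := by gcongr
end

section
/- Let R > 0 and x, y ∈ ℝ. If u is a random variable uniformly distributed on [0, R), then the probability that ⌊(x+u)/R⌋ ≠ ⌊(y+u)/R⌋ equals min(|x − y|, R)/R. -/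
open MeasureTheory

/-- The uniform probability measure on the interval `[0, R)`. -/
noncomputable def uniformIco (R : ℝ) : Measure ℝ :=
  (ENNReal.ofReal R)⁻¹ • volume.restrict (Set.Ico 0 R)

theorem floor_div_eq_iff_mul_le_and_lt {R : ℝ} (hR : 0 < R) (z : ℝ) (n : ℤ) :
    ⌊z / R⌋ = n ↔ n * R ≤ z ∧ z < (n + 1) * R := by
  rw [Int.floor_eq_iff, le_div_iff₀ hR, div_lt_iff₀ hR]

theorem volume_floor_div_ne_inter_Ico_of_le {R x y : ℝ} (hR : 0 < R) (hxy : x ≤ y) :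
    volume ({t : ℝ | ⌊(x + t) / R⌋ ≠ ⌊(y + t) / R⌋} ∩ Set.Ico 0 R) =
      ENNReal.ofReal (min (y - x) R) := by
  rcases le_or_gt R (y - x) with hD | hD
  · have hset : {t : ℝ | ⌊(x + t) / R⌋ ≠ ⌊(y + t) / R⌋} ∩ Set.Ico 0 R = Set.Ico 0 R := by
      refine Set.inter_eq_right.2 fun t _ h => ?_
      obtain ⟨h₁, -⟩ := (floor_div_eq_iff_mul_le_and_lt hR (x + t) _).1 rfl
      obtain ⟨-, h₂⟩ := (floor_div_eq_iff_mul_le_and_lt hR (y + t) _).1 h.symm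
      linarith
    rw [hset, min_eq_right hD, Real.volume_Ico, sub_zero]
  · obtain ⟨k, hk⟩ : ∃ k : ℤ, ⌊x / R⌋ = k := ⟨_, rfl⟩
    obtain ⟨hk₁, hk₂⟩ := (floor_div_eq_iff_mul_le_and_lt hR x k).1 hk
    obtain ⟨c, hc⟩ : ∃ c : ℝ, c = (k + 1) * R := ⟨_, rfl⟩
    have hset : {t : ℝ | ⌊(x + t) / R⌋ ≠ ⌊(y + t) / R⌋} ∩ Set.Ico 0 R =
        Set.Ico (max 0 (c - y)) (c - x) ∪ Set.Ico (c + R - y) R := by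
      ext t
      simp only [Set.mem_inter_iff, Set.mem_ofPred_eq, Set.mem_union, Set.mem_Ico, max_le_iff]
      have floor_eq (z : ℝ) (j : ℤ) (h₁ : c + (j - 1) * R ≤ z) (h₂ : z < c + j * R) :
          ⌊z / R⌋ = k + j := by
        rw [floor_div_eq_iff_mul_le_and_lt hR]
        push_cast
        constructor <;> linarith
      by_cases ht : 0 ≤ t ∧ t < R
      · obtain ⟨ht₀, ht₁⟩ := ht
        rcases lt_or_ge (x + t) c with hx | hx
        · rw [floor_eq (x + t) 0 (by push_cast; linarith) (by push_cast; linarith)]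
          rcases lt_or_ge (y + t) c with hy | hy
          · rw [floor_eq (y + t) 0 (by push_cast; linarith) (by push_cast; linarith)]
            simp only [ne_eq, not_true_eq_false, false_and, false_iff]
            rintro (h | h) <;> linarith
          · rw [floor_eq (y + t) 1 (by push_cast; linarith) (by push_cast; linarith)]
            refine iff_of_true ⟨by simp, ht₀, ht₁⟩ (Or.inl ⟨⟨ht₀, ?_⟩, ?_⟩) <;> linarith
        · rw [floor_eq (x + t) 1 (by push_cast; linarith) (by push_cast; linarith)]
          rcases lt_or_ge (y + t) (c + R) with hy | hy
          · rw [floor_eq (y + t) 1 (by push_cast; linarith) (by push_cast; linarith)]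
            simp only [ne_eq, not_true_eq_false, false_and, false_iff]
            rintro (h | h) <;> linarith
          · rw [floor_eq (y + t) 2 (by push_cast; linarith) (by push_cast; linarith)]
            refine iff_of_true ⟨by simp, ht₀, ht₁⟩ (Or.inr ⟨?_, ht₁⟩)
            linarith
      · refine iff_of_false (fun h => ht h.2) ?_
        rintro (h | h) <;> refine ht ⟨?_, ?_⟩ <;> linarith
    have hdisj : Disjoint (Set.Ico (max 0 (c - y)) (c - x)) (Set.Ico (c + R - y) R) := by
      refine Set.disjoint_left.2 fun t h₁ h₂ => ?_
      linarith [h₁.2, h₂.1]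
    rw [hset, measure_union hdisj measurableSet_Ico, Real.volume_Ico, Real.volume_Ico,
      min_eq_left hD.le]
    rcases le_total 0 (c - y) with h | h
    · rw [max_eq_right h, ENNReal.ofReal_of_nonpos (p := R - (c + R - y)) (by linarith), add_zero]
      congr 1
      ring
    · rw [max_eq_left h, ← ENNReal.ofReal_add (by linarith) (by linarith)]
      congr 1
      ring

theorem volume_floor_div_ne_inter_Ico {R : ℝ} (hR : 0 < R) (x y : ℝ) :
    volume ({t : ℝ | ⌊(x + t) / R⌋ ≠ ⌊(y + t) / R⌋} ∩ Set.Ico 0 R) =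
      ENNReal.ofReal (min |x - y| R) := by
  rcases le_total x y with h | h
  · rw [volume_floor_div_ne_inter_Ico_of_le hR h, abs_sub_comm, abs_of_nonneg (sub_nonneg.2 h)]
  · simp_rw [ne_comm (a := ⌊(x + _) / R⌋)]
    rw [volume_floor_div_ne_inter_Ico_of_le hR h, abs_of_nonneg (sub_nonneg.2 h)]

theorem uniformIco_ne_zero {R : ℝ} (hR : 0 < R) : uniformIco R ≠ 0 := by
  intro h
  have h_univ := congrArg (fun ν : Measure ℝ => ν Set.univ) h
  simp [uniformIco, hR.not_ge] at h_univ

/-- For a randomly shifted one-dimensional grid of side `R > 0`, with shift `u` uniform on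
`[0, R)`, the probability that two points `x, y ∈ ℝ` fall into different cells is exactly
`min(|x − y|, R) / R`. -/
theorem randomly_shifted_grid_separation_probability
    {Ω : Type} [MeasurableSpace Ω] (μ : Measure Ω) [IsProbabilityMeasure μ]
    (R x y : ℝ) (hR : 0 < R) (u : Ω → ℝ)
    (hu : Measure.map u μ = uniformIco R) :
    μ {ω | ⌊(x + u ω) / R⌋ ≠ ⌊(y + u ω) / R⌋} =
      ENNReal.ofReal (min |x - y| R / R) := by
  have hu_meas : AEMeasurable u μ :=
    AEMeasurable.of_map_ne_zero (hu ▸ uniformIco_ne_zero hR)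
  have hS : MeasurableSet {t : ℝ | ⌊(x + t) / R⌋ ≠ ⌊(y + t) / R⌋} :=
    (measurableSet_eq_fun (by fun_prop) (by fun_prop)).compl
  change μ (u ⁻¹' {t : ℝ | ⌊(x + t) / R⌋ ≠ ⌊(y + t) / R⌋}) = _
  rw [← Measure.map_apply_of_aemeasurable hu_meas hS, hu, uniformIco, Measure.smul_apply,
    Measure.restrict_apply hS, volume_floor_div_ne_inter_Ico hR, smul_eq_mul,
    ENNReal.ofReal_div_of_pos hR, ENNReal.div_eq_inv_mul]
end

section
/- Let R > 0, k ≥ 1, and x, y ∈ ℝ^k. Let u = (u₁,…,u_k) be a random vector whose coordinates are independent and uniformly distributed on [0, R), and define h_u(z) = (⌊(z₁+u₁)/R⌋, …, ⌊(z_k+u_k)/R⌋) for z ∈ ℝ^k. Then Pr[h_u(x) = h_u(y)] ≥ 1 − ‖x − y‖₁ / R. -/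
open MeasureTheory

theorem isProbabilityMeasure_uniformIco {R : ℝ} (hR : 0 < R) :
    IsProbabilityMeasure (uniformIco R) := by
  constructor
  have h : ENNReal.ofReal R ≠ 0 := by simpa using hR
  simp [uniformIco, ENNReal.inv_mul_cancel h ENNReal.ofReal_ne_top]

/-- The translates of a set `s` by multiples of `R` cover at most `volume s` of `[0, R)`. -/
theorem volume_iUnion_preimage_add_zsmul_inter_Ico_le {R : ℝ} {s : Set ℝ}
    (hs : MeasurableSet s) :
    volume ((⋃ n : ℤ, (· + n • R) ⁻¹' s) ∩ Set.Ico 0 R) ≤ volume s := by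
  have translate (n : ℤ) : volume ((· + n • R) ⁻¹' s ∩ Set.Ico 0 R) =
      volume (s ∩ Set.Ico (n • R) ((n + 1) • R)) := by
    rw [← measure_preimage_add_right volume (n • R) (s ∩ _)]
    congr 1
    ext t
    simp only [Set.mem_inter_iff, Set.mem_preimage, Set.mem_Ico, add_zsmul, one_zsmul]
    constructor <;> rintro ⟨h, h₁, h₂⟩ <;> exact ⟨h, by linarith, by linarith⟩
  calc volume ((⋃ n : ℤ, (· + n • R) ⁻¹' s) ∩ Set.Ico 0 R)
      ≤ ∑' n : ℤ, volume ((· + n • R) ⁻¹' s ∩ Set.Ico 0 R) := by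
        rw [Set.iUnion_inter]
        exact measure_iUnion_le _
    _ = ∑' n : ℤ, volume (s ∩ Set.Ico (n • R) ((n + 1) • R)) := by simp_rw [translate]
    _ ≤ volume (⋃ n : ℤ, s ∩ Set.Ico (n • R) ((n + 1) • R)) :=
        tsum_meas_le_meas_iUnion_of_disjoint _ (fun _ => hs.inter measurableSet_Ico)
          fun _ _ h => (Set.pairwise_disjoint_Ico_zsmul R h).mono
            Set.inter_subset_right Set.inter_subset_right
    _ ≤ volume s := measure_mono (Set.iUnion_subset fun _ => Set.inter_subset_left)

/-- A random shift separates two reals with probability at most their distance over `R`. -/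
theorem uniformIco_floor_ne_le {R : ℝ} (hR : 0 < R) (a b : ℝ) :
    uniformIco R {t | ⌊(a + t) / R⌋ ≠ ⌊(b + t) / R⌋} ≤ ENNReal.ofReal (|a - b| / R) := by
  wlog hab : a ≤ b generalizing a b
  · simpa only [ne_comm, abs_sub_comm] using this b a (le_of_not_ge hab)
  have cover : {t | ⌊(a + t) / R⌋ ≠ ⌊(b + t) / R⌋} ⊆
      ⋃ n : ℤ, (· + n • R) ⁻¹' Set.Ico (-b) (-a) := by
    intro t ht
    have hlt : ⌊(a + t) / R⌋ < ⌊(b + t) / R⌋ :=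
      lt_of_le_of_ne (Int.floor_le_floor (by gcongr)) ht
    have h₁ := Int.floor_lt.1 hlt
    have h₂ := Int.floor_le ((b + t) / R)
    rw [div_lt_iff₀ hR] at h₁
    rw [le_div_iff₀ hR] at h₂
    refine Set.mem_iUnion.2 ⟨-⌊(b + t) / R⌋, ?_⟩
    simp only [Set.mem_preimage, Set.mem_Ico, zsmul_eq_mul, Int.cast_neg]
    constructor <;> linarith
  have hvol : volume ({t | ⌊(a + t) / R⌋ ≠ ⌊(b + t) / R⌋} ∩ Set.Ico 0 R) ≤
      ENNReal.ofReal |a - b| := by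
    refine (measure_mono (Set.inter_subset_inter_left _ cover)).trans
      ((volume_iUnion_preimage_add_zsmul_inter_Ico_le measurableSet_Ico).trans_eq ?_)
    rw [Real.volume_Ico, abs_of_nonpos (sub_nonpos.2 hab)]
    congr 1
    ring
  rw [uniformIco, Measure.smul_apply, Measure.restrict_apply' measurableSet_Ico, smul_eq_mul,
    ENNReal.ofReal_div_of_pos hR, ENNReal.div_eq_inv_mul]
  gcongr

/-- For a randomly shifted grid of side `R > 0` in `ℝ^k` (shift vector with independent
coordinates, each uniform on `[0, R)`), the probability that two points `x, y ∈ ℝ^k`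
fall into the same cell is at least `1 − ‖x − y‖₁ / R`. -/
theorem randomly_shifted_grid_collision_lower_bound
    {Ω : Type} [MeasurableSpace Ω] (μ : Measure Ω) [IsProbabilityMeasure μ]
    (R : ℝ) (hR : 0 < R) (k : ℕ) (hk : 1 ≤ k) (x y : Fin k → ℝ)
    (u : Ω → Fin k → ℝ)
    (hu : Measure.map u μ = Measure.pi fun _ : Fin k => uniformIco R) :
    ENNReal.ofReal (1 - (∑ i, |x i - y i|) / R) ≤
      μ {ω | ∀ i, ⌊(x i + u ω i) / R⌋ = ⌊(y i + u ω i) / R⌋} := by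
  have := isProbabilityMeasure_uniformIco hR
  have hmeas : AEMeasurable u μ :=
    AEMeasurable.of_map_ne_zero (hu ▸ IsProbabilityMeasure.ne_zero _)
  have hfloor (a : ℝ) : Measurable fun t : ℝ => ⌊(a + t) / R⌋ :=
    ((measurable_id.const_add a).div_const R).floor
  have hne (i : Fin k) : MeasurableSet {t | ⌊(x i + t) / R⌋ ≠ ⌊(y i + t) / R⌋} :=
    (measurableSet_eq_fun (hfloor _) (hfloor _)).compl
  let E : Set (Fin k → ℝ) := {v | ∀ i, ⌊(x i + v i) / R⌋ = ⌊(y i + v i) / R⌋}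
  have hcompl : Eᶜ = ⋃ i, Function.eval i ⁻¹' {t | ⌊(x i + t) / R⌋ ≠ ⌊(y i + t) / R⌋} := by
    ext v
    simp [E]
  have hE : MeasurableSet E := by
    rw [← MeasurableSet.compl_iff, hcompl]
    exact MeasurableSet.iUnion fun i => measurable_pi_apply i (hne i)
  have hbad : (Measure.pi fun _ : Fin k => uniformIco R) Eᶜ ≤
      ENNReal.ofReal ((∑ i, |x i - y i|) / R) := by
    rw [hcompl, Finset.sum_div, ENNReal.ofReal_sum_of_nonneg fun i _ => by positivity]
    refine (measure_iUnion_fintype_le _ _).trans (Finset.sum_le_sum fun i _ => ?_)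
    rw [(measurePreserving_eval (fun _ : Fin k => uniformIco R) i).measure_preimage
      (hne i).nullMeasurableSet]
    exact uniformIco_floor_ne_le hR _ _
  change _ ≤ μ (u ⁻¹' E)
  rw [← Measure.map_apply_of_aemeasurable hmeas hE, hu, ← compl_compl E,
    prob_compl_eq_one_sub hE.compl, ENNReal.ofReal_sub _ (by positivity), ENNReal.ofReal_one]
  gcongr
end

section
/- Let R > 0, k ≥ 1, and x, y ∈ ℝ^k. Let u = (u₁,…,u_k) be a random vector whose coordinates are independent and uniformly distributed on [0, R), and define h_u(z) = (⌊(z₁+u₁)/R⌋, …, ⌊(z_k+u_k)/R⌋) for z ∈ ℝ^k. Then Pr[h_u(x) = h_u(y)] ≤ exp(−‖x − y‖₁ / R). -/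
open MeasureTheory

/-- The shifts in `[0, R)` that put `a ≤ b` into the same cell lie in two intervals. -/
theorem floor_collision_inter_Ico_subset {R : ℝ} (hR : 0 < R) {a b : ℝ} (hab : a ≤ b) :
    {t : ℝ | ⌊(a + t) / R⌋ = ⌊(b + t) / R⌋} ∩ Set.Ico 0 R ⊆
      Set.Ico 0 (R - (a - ⌊a / R⌋ * R) - (b - a)) ∪
        Set.Ico (R - (a - ⌊a / R⌋ * R)) (min R (2 * R - (a - ⌊a / R⌋ * R) - (b - a))) := by
  rintro t ⟨ht, ht0, htR⟩
  have hf0 : ⌊a / R⌋ * R ≤ a := (le_div_iff₀ hR).1 (Int.floor_le _)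
  have hfR : a < (⌊a / R⌋ + 1) * R := (div_lt_iff₀ hR).1 (Int.lt_floor_add_one _)
  have h1 : ⌊(a + t) / R⌋ * R ≤ a + t := (le_div_iff₀ hR).1 (Int.floor_le _)
  have h2 : b + t < (⌊(a + t) / R⌋ + 1) * R := by
    rw [Set.mem_ofPred_eq.mp ht]
    exact (div_lt_iff₀ hR).1 (Int.lt_floor_add_one _)
  generalize ⌊(a + t) / R⌋ = m at h1 h2
  generalize ⌊a / R⌋ = n at *
  obtain ⟨j, rfl⟩ : ∃ j, m = n + j := ⟨m - n, by ring⟩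
  push_cast at h1 h2
  have hj2 : (j : ℝ) < 2 := lt_of_mul_lt_mul_right (by linarith) hR.le
  have hj0 : (-1 : ℝ) < j := lt_of_mul_lt_mul_right (by linarith) hR.le
  have hj2' : j < 2 := by exact_mod_cast hj2
  have hj0' : -1 < j := by exact_mod_cast hj0
  obtain rfl | rfl : j = 0 ∨ j = 1 := by omega
  · left
    push_cast at h1 h2
    constructor <;> linarith
  · right
    push_cast at h1 h2
    exact ⟨by linarith, lt_min htR (by linarith)⟩

theorem uniformIco_floor_collision_le_of_le {R : ℝ} (hR : 0 < R) {a b : ℝ} (hab : a ≤ b) :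
    uniformIco R {t : ℝ | ⌊(a + t) / R⌋ = ⌊(b + t) / R⌋} ≤
      ENNReal.ofReal (1 - (b - a) / R) := by
  have hf0 : ⌊a / R⌋ * R ≤ a := (le_div_iff₀ hR).1 (Int.floor_le _)
  have hvol : volume ({t : ℝ | ⌊(a + t) / R⌋ = ⌊(b + t) / R⌋} ∩ Set.Ico 0 R) ≤
      ENNReal.ofReal (R - (b - a)) := by
    refine (measure_mono (floor_collision_inter_Ico_subset hR hab)).trans
      ((measure_union_le _ _).trans ?_)
    rw [Real.volume_Ico, Real.volume_Ico]
    generalize (⌊a / R⌋ : ℝ) * R = c at *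
    rcases le_total (a - c) (R - (b - a)) with h | h
    · rw [min_eq_left (by linarith), ← ENNReal.ofReal_add (by linarith) (by linarith)]
      exact ENNReal.ofReal_le_ofReal (by linarith)
    · rw [min_eq_right (by linarith), ENNReal.ofReal_of_nonpos (by linarith), zero_add]
      exact ENNReal.ofReal_le_ofReal (by linarith)
  rw [uniformIco, Measure.smul_apply, Measure.restrict_apply' measurableSet_Ico, smul_eq_mul,
    ← ENNReal.ofReal_inv_of_pos hR]
  calc _ ≤ ENNReal.ofReal R⁻¹ * ENNReal.ofReal (R - (b - a)) := by gcongr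
    _ = ENNReal.ofReal (1 - (b - a) / R) := by
      rw [← ENNReal.ofReal_mul (by positivity)]
      congr 1
      field_simp

theorem uniformIco_floor_collision_le {R : ℝ} (hR : 0 < R) (a b : ℝ) :
    uniformIco R {t : ℝ | ⌊(a + t) / R⌋ = ⌊(b + t) / R⌋} ≤
      ENNReal.ofReal (Real.exp (-|a - b| / R)) := by
  have key : uniformIco R {t : ℝ | ⌊(a + t) / R⌋ = ⌊(b + t) / R⌋} ≤
      ENNReal.ofReal (1 - |a - b| / R) := by
    rcases le_total a b with h | h
    · rw [abs_sub_comm, abs_of_nonneg (sub_nonneg.2 h)]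
      exact uniformIco_floor_collision_le_of_le hR h
    · rw [abs_of_nonneg (sub_nonneg.2 h)]
      simpa only [eq_comm] using uniformIco_floor_collision_le_of_le hR h
  refine key.trans (ENNReal.ofReal_le_ofReal ?_)
  rw [neg_div]
  exact Real.one_sub_le_exp_neg _

/-- For a randomly shifted grid of side `R > 0` in `ℝ^k` (shift vector with independent
coordinates, each uniform on `[0, R)`), the probability that two points `x, y ∈ ℝ^k`
fall into the same cell is at most `exp(−‖x − y‖₁ / R)`. -/
theorem randomly_shifted_grid_collision_upper_bound
    {Ω : Type} [MeasurableSpace Ω] (μ : Measure Ω) [IsProbabilityMeasure μ]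
    (R : ℝ) (hR : 0 < R) (k : ℕ) (hk : 1 ≤ k) (x y : Fin k → ℝ)
    (u : Ω → Fin k → ℝ)
    (hu : Measure.map u μ = Measure.pi fun _ : Fin k => uniformIco R) :
    μ {ω | ∀ i, ⌊(x i + u ω i) / R⌋ = ⌊(y i + u ω i) / R⌋} ≤
      ENNReal.ofReal (Real.exp (-(∑ i, |x i - y i|) / R)) := by
  have := isProbabilityMeasure_uniformIco hR
  have hu' : AEMeasurable u μ := by
    apply AEMeasurable.of_map_ne_zero
    rw [hu]
    exact IsProbabilityMeasure.ne_zero _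
  calc μ {ω | ∀ i, ⌊(x i + u ω i) / R⌋ = ⌊(y i + u ω i) / R⌋}
      = μ (u ⁻¹' Set.univ.pi fun i => {t | ⌊(x i + t) / R⌋ = ⌊(y i + t) / R⌋}) := by
        congr 1
        ext ω
        simp
    _ ≤ μ.map u (Set.univ.pi fun i => {t | ⌊(x i + t) / R⌋ = ⌊(y i + t) / R⌋}) :=
        Measure.le_map_apply hu' _
    _ = ∏ i, uniformIco R {t | ⌊(x i + t) / R⌋ = ⌊(y i + t) / R⌋} := by
        rw [hu, Measure.pi_pi]
    _ ≤ ∏ i, ENNReal.ofReal (Real.exp (-|x i - y i| / R)) :=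
        Finset.prod_le_prod' fun i _ => uniformIco_floor_collision_le hR _ _
    _ = ENNReal.ofReal (Real.exp (-(∑ i, |x i - y i|) / R)) := by
        rw [← ENNReal.ofReal_prod_of_nonneg fun _ _ => (Real.exp_pos _).le, ← Real.exp_sum,
          ← Finset.sum_div, Finset.sum_neg_distrib]
end
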